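/- arXiv:0911.0606 — 2 statements merged into one kernel-verified Lean document; each statement's English description precedes it below -/
import Mathlib

section
/- (Grothendieck's characterisation of Schur multipliers.) Let φ : ℕ × ℕ → ℂ be a bounded function and C > 0. The following are equivalent: (i) φ is a Schur multiplier and ‖φ‖_m < C; (ii) there exist sequences of bounded functions a_k, b_k : ℕ → ℂ (k ∈ ℕ) such that sup_{i ∈ ℕ} Σ_{k=1}^∞ |a_k(i)|² < C, sup_{j ∈ ℕ} Σ_{k=1}^∞ |b_k(j)|² < C, and φ(i,j) = Σ_{k=1}^∞ a_k(i) b_k(j) for all i, j ∈ ℕ. -/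
open scoped InnerProductSpace

noncomputable section

/-- The Hilbert space `ℓ² = ℓ²(ℕ, ℂ)`. -/
abbrev l2 : Type := lp (fun _ : ℕ => ℂ) 2

/-- The standard orthonormal basis vector `e i` of `ℓ²`. -/
def e (i : ℕ) : l2 := lp.single 2 i 1

/-- The matrix entry `a(i,j) = ⟪A e_j, e_i⟫` of a bounded operator `A` on `ℓ²`. -/
def ent (A : l2 →L[ℂ] l2) (i j : ℕ) : ℂ := ⟪A (e j), e i⟫_ℂ

/-- A function `φ : ℕ × ℕ → ℂ` is a Schur multiplier if for every bounded operator `A` on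
`ℓ²` there is a bounded operator on `ℓ²` whose matrix is `(φ(i,j) * a(i,j))`. -/
def IsSchurMultiplier (φ : ℕ × ℕ → ℂ) : Prop :=
  ∀ A : l2 →L[ℂ] l2, ∃ B : l2 →L[ℂ] l2, ∀ i j, ent B i j = φ (i, j) * ent A i j

open scoped ComplexConjugate

lemma inner_e_left (i : ℕ) (x : l2) : ⟪e i, x⟫_ℂ = x i := by
  simp [e, lp.inner_single_left]

lemma inner_e_right (i : ℕ) (x : l2) : ⟪x, e i⟫_ℂ = conj (x i) := by
  rw [← inner_conj_symm, inner_e_left]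

lemma e_apply (i j : ℕ) : (e i : l2) j = if j = i then 1 else 0 := by
  rw [e, lp.single_apply]
  split_ifs with h
  · subst h; simp
  · simp [h]

lemma sum_sq_le (x : l2) (n : ℕ) : ∑ i ∈ Finset.range n, ‖x i‖ ^ 2 ≤ ‖x‖ ^ 2 := by
  have := lp.sum_rpow_le_norm_rpow (p := 2) (by norm_num) x (Finset.range n)
  simpa using this

/-- finite matrix operator with `ent = α`. -/
def finOp (n : ℕ) (α : ℕ → ℕ → ℂ) : l2 →L[ℂ] l2 :=
  ∑ i ∈ Finset.range n, ∑ j ∈ Finset.range n,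
    conj (α i j) • (innerSL ℂ (e j)).smulRight (e i)

lemma inner_finOp (n : ℕ) (α : ℕ → ℕ → ℂ) (x y : l2) :
    ⟪finOp n α x, y⟫_ℂ = ∑ i ∈ Finset.range n, ∑ j ∈ Finset.range n, α i j * conj (x j) * y i := by
  simp only [finOp]
  simp [inner_e_left]
  refine Finset.sum_congr rfl fun i _ => Finset.sum_congr rfl fun j _ => ?_
  ring

lemma ent_finOp (n : ℕ) (α : ℕ → ℕ → ℂ) {i j : ℕ} (hi : i < n) (hj : j < n) :
    ent (finOp n α) i j = α i j := by
  rw [ent, inner_finOp, Finset.sum_eq_single i, Finset.sum_eq_single j] <;>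
    simp +contextual [e_apply, hi, hj]

lemma norm_sq_vec (n : ℕ) (c : ℕ → ℝ) (hc : ∀ i ∈ Finset.range n, 0 ≤ c i) :
    ‖∑ i ∈ Finset.range n, ((√(c i) : ℝ) : ℂ) • e i‖ ^ 2 = ∑ i ∈ Finset.range n, c i := by
  have h : Orthonormal ℂ e := by
    rw [orthonormal_iff_ite]
    intro i j
    rw [inner_e_left, e_apply]
  have h2 := h.inner_sum (fun i => ((√(c i) : ℝ) : ℂ)) (fun i => ((√(c i) : ℝ) : ℂ)) (Finset.range n)
  rw [inner_self_eq_norm_sq_to_K] at h2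
  have h3 : ∑ i ∈ Finset.range n, (starRingEnd ℂ) ((√(c i) : ℝ) : ℂ) * ((√(c i) : ℝ) : ℂ)
     = ((∑ i ∈ Finset.range n, c i : ℝ) : ℂ) := by
    rw [Complex.ofReal_sum]
    refine Finset.sum_congr rfl fun i hi => ?_
    rw [Complex.conj_ofReal, ← Complex.ofReal_mul, Real.mul_self_sqrt (hc i hi)]
  rw [h3] at h2
  exact Complex.ofReal_injective (by rw [Complex.ofReal_pow]; exact h2)

theorem fin_key (φ : ℕ × ℕ → ℂ) (S : (l2 →L[ℂ] l2) →L[ℂ] (l2 →L[ℂ] l2))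
    (hS : ∀ A : l2 →L[ℂ] l2, ∀ i j, ent (S A) i j = φ (i, j) * ent A i j)
    (n : ℕ) (d f : ℕ → ℝ) (Y : ℕ → ℕ → ℂ)
    (H : ∀ x y : ℕ → ℂ, 0 ≤ ∑ i ∈ Finset.range n, d i * ‖x i‖ ^ 2
      + ∑ j ∈ Finset.range n, f j * ‖y j‖ ^ 2
      + 2 * (∑ i ∈ Finset.range n, ∑ j ∈ Finset.range n, Y i j * (conj (x i) * y j)).re) :
    0 ≤ ‖S‖ * (∑ i ∈ Finset.range n, d i + ∑ j ∈ Finset.range n, f j)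
      + 2 * (∑ i ∈ Finset.range n, ∑ j ∈ Finset.range n, Y i j * φ (i, j)).re := by
  have Hd : ∀ i ∈ Finset.range n, 0 ≤ d i := by
    intro i hi
    have := H (Pi.single i 1) 0
    simpa [Pi.single_apply, apply_ite, Finset.mem_range.1 hi] using this
  have Hf : ∀ i ∈ Finset.range n, 0 ≤ f i := by
    intro i hi
    have := H 0 (Pi.single i 1)
    simpa [Pi.single_apply, apply_ite, Finset.mem_range.1 hi] using this
  have H2 : ∀ i ∈ Finset.range n, ∀ j ∈ Finset.range n, ∀ s t : ℂ,
      0 ≤ d i * ‖s‖ ^ 2 + f j * ‖t‖ ^ 2 + 2 * (Y i j * (conj s * t)).re := by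
    intro i hi j hj s t
    have := H (Pi.single i s) (Pi.single j t)
    simpa [Pi.single_apply, apply_ite, Finset.mem_range.1 hi, Finset.mem_range.1 hj] using this
  have Hd0 : ∀ i ∈ Finset.range n, ∀ j ∈ Finset.range n, d i = 0 → Y i j = 0 := by
    intro i hi j hj h0
    by_contra hne
    have hpos : 0 < ‖Y i j‖ ^ 2 := by positivity
    have := H2 i hi j hj (-(((f j + 1) / ‖Y i j‖ ^ 2 : ℝ) : ℂ) * Y i j) 1
    have e1 : Y i j * (conj (-(((f j + 1) / ‖Y i j‖ ^ 2 : ℝ) : ℂ) * Y i j) * 1)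
      = ((-(f j + 1) : ℝ) : ℂ) := by
      have h3 : Y i j * conj (Y i j) = ((‖Y i j‖ ^ 2 : ℝ) : ℂ) := by
        rw [Complex.mul_conj, Complex.normSq_eq_norm_sq]
      rw [map_mul, map_neg, Complex.conj_ofReal, mul_one, mul_left_comm, h3, ← Complex.ofReal_neg,
        ← Complex.ofReal_mul]
      congr 1
      field_simp
    rw [e1, h0, Complex.ofReal_re] at this
    have := Hf j hj
    simp at *
    linarith
  have Hf0 : ∀ i ∈ Finset.range n, ∀ j ∈ Finset.range n, f j = 0 → Y i j = 0 := by
    intro i hi j hj h0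
    by_contra hne
    have hpos : 0 < ‖Y i j‖ ^ 2 := by positivity
    have := H2 i hi j hj 1 (-(((d i + 1) / ‖Y i j‖ ^ 2 : ℝ) : ℂ) * conj (Y i j))
    have e1 : Y i j * (conj 1 * (-(((d i + 1) / ‖Y i j‖ ^ 2 : ℝ) : ℂ) * conj (Y i j)))
      = ((-(d i + 1) : ℝ) : ℂ) := by
      have h3 : Y i j * conj (Y i j) = ((‖Y i j‖ ^ 2 : ℝ) : ℂ) := by
        rw [Complex.mul_conj, Complex.normSq_eq_norm_sq]
      rw [map_one, one_mul, mul_left_comm, h3, ← Complex.ofReal_neg,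
        ← Complex.ofReal_mul]
      congr 1
      field_simp
    rw [e1, h0, Complex.ofReal_re] at this
    have := Hd i hi
    simp at *
    linarith
  set α : ℕ → ℕ → ℂ := fun i j => Y i j / (((√(d i) : ℝ) : ℂ) * ((√(f j) : ℝ) : ℂ)) with hα
  have hY : ∀ i ∈ Finset.range n, ∀ j ∈ Finset.range n,
      Y i j = α i j * (((√(d i) : ℝ) : ℂ) * ((√(f j) : ℝ) : ℂ)) := by
    intro i hi j hj
    by_cases h1 : d i = 0
    · rw [hα]; simp [Hd0 i hi j hj h1]
    by_cases h2 : f j = 0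
    · rw [hα]; simp [Hf0 i hi j hj h2]
    have h1' : 0 < d i := lt_of_le_of_ne (Hd i hi) (Ne.symm h1)
    have h2' : 0 < f j := lt_of_le_of_ne (Hf j hj) (Ne.symm h2)
    have h3 : (((√(d i) : ℝ) : ℂ) * ((√(f j) : ℝ) : ℂ)) ≠ 0 := by
      refine mul_ne_zero ?_ ?_ <;> exact_mod_cast (Real.sqrt_pos.2 (by assumption)).ne'
    simp only [hα]
    rw [div_mul_cancel₀ _ h3]
  have aux : ∀ (c : ℕ → ℝ), (∀ i ∈ Finset.range n, 0 ≤ c i) → ∀ x : l2,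
      ∑ i ∈ Finset.range n, c i * ‖x i / ((√(c i) : ℝ) : ℂ)‖ ^ 2 ≤ ‖x‖ ^ 2 := by
    intro c hc x
    refine le_trans (Finset.sum_le_sum fun i hi => ?_) (sum_sq_le x n)
    rw [norm_div, div_pow, Complex.norm_real, Real.norm_eq_abs, sq_abs, Real.sq_sqrt (hc i hi)]
    by_cases h : c i = 0
    · simp [h]
    · rw [mul_div_cancel₀ _ h]
  have hA : ‖finOp n α‖ ≤ 1 := by
    refine ContinuousLinearMap.opNorm_le_of_re_inner_le zero_le_one fun x y hx hy => ?_
    have h1 := H (fun i => -conj (y i / ((√(d i) : ℝ) : ℂ))) (fun j => conj (x j / ((√(f j) : ℝ) : ℂ)))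
    simp only [norm_neg, RCLike.norm_conj] at h1
    have h2 := aux d Hd y
    have h3 := aux f Hf x
    have h4 : ∑ i ∈ Finset.range n, ∑ j ∈ Finset.range n, Y i j *
       (conj (-conj (y i / ((√(d i) : ℝ) : ℂ))) * conj (x j / ((√(f j) : ℝ) : ℂ))) =
       - ⟪finOp n α x, y⟫_ℂ := by
      rw [inner_finOp, ← Finset.sum_neg_distrib]
      refine Finset.sum_congr rfl fun i hi => ?_
      rw [← Finset.sum_neg_distrib]
      refine Finset.sum_congr rfl fun j hj => ?_
      simp only [hα, map_neg, Complex.conj_conj, map_div₀, Complex.conj_ofReal]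
      ring
    rw [h4, Complex.neg_re] at h1
    have hx' : ‖x‖ ^ 2 ≤ 1 := by simp [hx]
    have hy' : ‖y‖ ^ 2 ≤ 1 := by simp [hy]
    have : (⟪finOp n α x, y⟫_ℂ).re ≤ 1 := by linarith
    simpa [hx, hy] using this
  set u : l2 := ∑ j ∈ Finset.range n, ((√(f j) : ℝ) : ℂ) • e j with hu
  set v : l2 := ∑ i ∈ Finset.range n, ((√(d i) : ℝ) : ℂ) • e i with hv
  have hun : ‖u‖ ^ 2 = _ := norm_sq_vec n f Hf
  have hvn : ‖v‖ ^ 2 = _ := norm_sq_vec n d Hd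
  have hin : ⟪S (finOp n α) u, v⟫_ℂ =
      ∑ i ∈ Finset.range n, ∑ j ∈ Finset.range n, Y i j * φ (i, j) := by
    rw [hu, hv, inner_sum]
    refine Finset.sum_congr rfl fun i hi => ?_
    rw [map_sum, sum_inner]
    refine Finset.sum_congr rfl fun j hj => ?_
    rw [map_smul, inner_smul_left, inner_smul_right, Complex.conj_ofReal]
    change _ * (_ * ent (S (finOp n α)) i j) = _
    rw [hS, ent_finOp n α (Finset.mem_range.1 hi) (Finset.mem_range.1 hj), hY i hi j hj]
    ring
  rw [← hin, ← hun, ← hvn]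
  have b1 : ‖⟪S (finOp n α) u, v⟫_ℂ‖ ≤ ‖S‖ * (‖u‖ * ‖v‖) := by
    calc _ ≤ ‖S (finOp n α) u‖ * ‖v‖ := norm_inner_le_norm _ _
      _ ≤ (‖S (finOp n α)‖ * ‖u‖) * ‖v‖ := by gcongr; exact ContinuousLinearMap.le_opNorm _ _
      _ ≤ ((‖S‖ * ‖finOp n α‖) * ‖u‖) * ‖v‖ := by gcongr; exact ContinuousLinearMap.le_opNorm _ _
      _ ≤ ((‖S‖ * 1) * ‖u‖) * ‖v‖ := by gcongr
      _ = _ := by ring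
  have b2 := (abs_le.1 ((Complex.abs_re_le_norm _).trans b1)).1
  have b3 : ‖S‖ * (2 * (‖u‖ * ‖v‖)) ≤ ‖S‖ * (‖v‖ ^ 2 + ‖u‖ ^ 2) := by
    gcongr; nlinarith [sq_nonneg (‖u‖ - ‖v‖)]
  linarith


abbrev II : Type := ℕ ⊕ ℕ
abbrev EE : Type := (II × II) →₀ ℂ

def LL (K : II → II → ℂ) : EE →ₗ[ℝ] ℝ :=
  Complex.reLm ∘ₗ (Finsupp.linearCombination ℂ (fun p : II × II => K p.1 p.2)).restrictScalars ℝ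

lemma LL_single (K : II → II → ℂ) (a b : II) (z : ℂ) :
    LL K (Finsupp.single (a, b) z) = (z * K a b).re := by
  simp [LL]

def coneE : PointedCone ℝ EE where
  carrier := {Z | ∀ x : II → ℂ, 0 ≤ LL (fun a b => conj (x a) * x b) Z}
  add_mem' := by
    intro a b ha hb x
    rw [map_add]
    exact add_nonneg (ha x) (hb x)
  zero_mem' := by intro x; simp
  smul_mem' := by
    intro c Z hZ x
    have : c • Z = (c : ℝ) • Z := rfl
    rw [this, map_smul]
    exact mul_nonneg c.2 (hZ x)

lemma mem_coneE (Z : EE) : Z ∈ coneE ↔ ∀ x : II → ℂ, 0 ≤ LL (fun a b => conj (x a) * x b) Z :=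
  Iff.rfl

def WW : Submodule ℝ EE where
  carrier := {Z | ∀ i j, i ≠ j → Z (Sum.inl i, Sum.inl j) = 0 ∧ Z (Sum.inr i, Sum.inr j) = 0}
  add_mem' := by
    intro a b ha hb i j hij
    simp [ha i j hij, hb i j hij]
  zero_mem' := by intro i j hij; simp
  smul_mem' := by
    intro c Z hZ i j hij
    simp [hZ i j hij]

lemma mem_WW (Z : EE) : Z ∈ WW ↔
  ∀ i j, i ≠ j → Z (Sum.inl i, Sum.inl j) = 0 ∧ Z (Sum.inr i, Sum.inr j) = 0 := Iff.rfl

lemma single_diag_mem (a : II) (z : ℂ) : (Finsupp.single (a, a) z : EE) ∈ WW := by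
  rw [mem_WW]
  intro i j hij
  rcases a with a | a
  · refine ⟨Finsupp.single_eq_of_ne ?_, Finsupp.single_eq_of_ne ?_⟩ <;> simp
    intro h1 h2; exact hij (by omega)
  · refine ⟨Finsupp.single_eq_of_ne ?_, Finsupp.single_eq_of_ne ?_⟩ <;> simp
    intro h1 h2; exact hij (by omega)

lemma single_off_mem (i j : ℕ) (z : ℂ) :
    (Finsupp.single (Sum.inl i, Sum.inr j) z : EE) ∈ WW := by
  rw [mem_WW]
  intro i j hij
  refine ⟨Finsupp.single_eq_of_ne ?_, Finsupp.single_eq_of_ne ?_⟩ <;> simp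

lemma dense_WW (y : EE) : ∃ x : WW, (x : EE) + y ∈ coneE := by
  induction y using Finsupp.induction_linear with
  | zero => exact ⟨0, by simp⟩
  | add f g hf hg =>
    obtain ⟨x, hx⟩ := hf
    obtain ⟨y, hy⟩ := hg
    refine ⟨x + y, ?_⟩
    have := add_mem hx hy
    rw [Submodule.coe_add, add_add_add_comm]
    exact this
  | single p z =>
    obtain ⟨a, b⟩ := p
    refine ⟨⟨Finsupp.single (a, a) (‖z‖ : ℂ) + Finsupp.single (b, b) (‖z‖ : ℂ),
      add_mem (single_diag_mem _ _) (single_diag_mem _ _)⟩, ?_⟩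
    rw [mem_coneE]
    intro x
    have h1 : ∀ a, ((‖z‖ : ℂ) * (conj (x a) * x a)).re = ‖z‖ * ‖x a‖ ^ 2 := by
      intro a
      rw [← Complex.normSq_eq_conj_mul_self, Complex.normSq_eq_norm_sq, ← Complex.ofReal_mul,
        Complex.ofReal_re]
    have h2 := (abs_le.1 (Complex.abs_re_le_norm (z * (conj (x a) * x b)))).1
    rw [norm_mul, norm_mul, RCLike.norm_conj] at h2
    simp only [map_add, LL_single, h1]
    nlinarith [mul_nonneg (norm_nonneg z) (sq_nonneg (‖x a‖ - ‖x b‖)),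
      mul_nonneg (norm_nonneg z) (add_nonneg (sq_nonneg ‖x a‖) (sq_nonneg ‖x b‖))]

lemma block (Z : EE) (hZ : Z ∈ WW) : ∃ (n : ℕ) (d f : ℕ → ℝ) (Y : ℕ → ℕ → ℂ),
    ∀ K : II → II → ℂ, (∀ a b, K b a = conj (K a b)) →
      LL K Z = ∑ i ∈ Finset.range n, d i * (K (Sum.inl i) (Sum.inl i)).re
        + ∑ j ∈ Finset.range n, f j * (K (Sum.inr j) (Sum.inr j)).re
        + 2 * (∑ i ∈ Finset.range n, ∑ j ∈ Finset.range n, Y i j * K (Sum.inl i) (Sum.inr j)).re := by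
  obtain ⟨n, hn⟩ : ∃ n : ℕ, Z.support ⊆
      ((Finset.range n).disjSum (Finset.range n)) ×ˢ ((Finset.range n).disjSum (Finset.range n)) := by
    let g : II → ℕ := fun a => a.elim id id
    refine ⟨Z.support.sup (fun p => max (g p.1) (g p.2)) + 1, fun p hp => ?_⟩
    have h := Finset.le_sup (f := fun p : II × II => max (g p.1) (g p.2)) hp
    obtain ⟨a, b⟩ := p
    have h1 : g a ≤ _ := (le_max_left _ _).trans h
    have h2 : g b ≤ _ := (le_max_right _ _).trans h
    rw [Finset.mem_product]
    constructor
    · rcases a with a | a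
      · exact Finset.inl_mem_disjSum.2 (Finset.mem_range.2 (Nat.lt_succ_of_le h1))
      · exact Finset.inr_mem_disjSum.2 (Finset.mem_range.2 (Nat.lt_succ_of_le h1))
    · rcases b with b | b
      · exact Finset.inl_mem_disjSum.2 (Finset.mem_range.2 (Nat.lt_succ_of_le h2))
      · exact Finset.inr_mem_disjSum.2 (Finset.mem_range.2 (Nat.lt_succ_of_le h2))
  refine ⟨n, fun i => (Z (Sum.inl i, Sum.inl i)).re, fun i => (Z (Sum.inr i, Sum.inr i)).re,
    fun i j => (Z (Sum.inl i, Sum.inr j) + conj (Z (Sum.inr j, Sum.inl i))) / 2, fun K hK => ?_⟩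
  have hdiag : ∀ a, (K a a).im = 0 := by
    intro a
    have := congrArg Complex.im (hK a a)
    rw [Complex.conj_im] at this
    linarith
  have e0 : LL K Z = (∑ p ∈ ((Finset.range n).disjSum (Finset.range n)) ×ˢ
      ((Finset.range n).disjSum (Finset.range n)), Z p * K p.1 p.2).re := by
    simp only [LL, LinearMap.comp_apply, LinearMap.restrictScalars_apply,
      Finsupp.linearCombination_apply, Complex.reLm_coe]
    rw [Finsupp.sum_of_support_subset _ hn _ (by simp)]
    rfl
  rw [e0, Finset.sum_product, Finset.sum_disjSum]
  simp only [Finset.sum_disjSum, Finset.sum_add_distrib, Complex.add_re, Complex.re_sum]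
  have e1 : ∀ i ∈ Finset.range n, ∑ x ∈ Finset.range n,
      (Z (Sum.inl i, Sum.inl x) * K (Sum.inl i) (Sum.inl x)).re =
      (Z (Sum.inl i, Sum.inl i)).re * (K (Sum.inl i) (Sum.inl i)).re := by
    intro i hi
    rw [Finset.sum_eq_single i]
    · rw [Complex.mul_re, hdiag]; ring
    · intro j _ hj
      rw [(hZ i j (Ne.symm hj)).1]; simp
    · intro h; exact absurd hi h
  have e2 : ∀ i ∈ Finset.range n, ∑ x ∈ Finset.range n,
      (Z (Sum.inr i, Sum.inr x) * K (Sum.inr i) (Sum.inr x)).re =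
      (Z (Sum.inr i, Sum.inr i)).re * (K (Sum.inr i) (Sum.inr i)).re := by
    intro i hi
    rw [Finset.sum_eq_single i]
    · rw [Complex.mul_re, hdiag]; ring
    · intro j _ hj
      rw [(hZ i j (Ne.symm hj)).2]; simp
    · intro h; exact absurd hi h
  rw [Finset.sum_congr rfl e1, Finset.sum_congr rfl e2,
    Finset.sum_comm (f := fun x y => (Z (Sum.inr x, Sum.inl y) * K (Sum.inr x) (Sum.inl y)).re)]
  have e3 : ∑ i ∈ Finset.range n, ∑ j ∈ Finset.range n,
        (Z (Sum.inl i, Sum.inr j) * K (Sum.inl i) (Sum.inr j)).re +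
      ∑ i ∈ Finset.range n, ∑ j ∈ Finset.range n,
        (Z (Sum.inr j, Sum.inl i) * K (Sum.inr j) (Sum.inl i)).re =
      2 * ∑ i ∈ Finset.range n, ∑ j ∈ Finset.range n,
       ((Z (Sum.inl i, Sum.inr j) + conj (Z (Sum.inr j, Sum.inl i))) / 2
          * K (Sum.inl i) (Sum.inr j)).re := by
    simp only [← Finset.sum_add_distrib, Finset.mul_sum]
    refine Finset.sum_congr rfl fun i _ => Finset.sum_congr rfl fun j _ => ?_
    rw [hK (Sum.inl i) (Sum.inr j)]
    simp [Complex.mul_re, Complex.div_re, Complex.div_im, Complex.normSq]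
    ring
  linarith

theorem exists_kernel (φ : ℕ × ℕ → ℂ) (S : (l2 →L[ℂ] l2) →L[ℂ] (l2 →L[ℂ] l2))
    (hS : ∀ A : l2 →L[ℂ] l2, ∀ i j, ent (S A) i j = φ (i, j) * ent A i j) :
    ∃ G : II → II → ℂ, (∀ a b, G b a = conj (G a b)) ∧ (∀ a, G a a = ‖S‖) ∧
      (∀ i j, G (Sum.inl i) (Sum.inr j) = φ (i, j)) ∧
      ∀ w : II →₀ ℂ, 0 ≤ (w.sum fun a z => w.sum fun b z' => conj z * z' * G a b).re := by
  let G0 : II → II → ℂ := fun a b => match a, b with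
    | Sum.inl i, Sum.inl j => if i = j then (‖S‖ : ℂ) else 0
    | Sum.inr i, Sum.inr j => if i = j then (‖S‖ : ℂ) else 0
    | Sum.inl i, Sum.inr j => φ (i, j)
    | Sum.inr j, Sum.inl i => conj (φ (i, j))
  have hG0 : ∀ a b, G0 b a = conj (G0 a b) := by
    rintro (a | a) (b | b) <;> simp [G0, apply_ite conj, eq_comm]
  have nonneg : ∀ x : WW, (x : EE) ∈ coneE → 0 ≤ LL G0 x := by
    rintro ⟨Z, hZ⟩ hc
    obtain ⟨n, d, f, Y, hb⟩ := block Z hZ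
    have h1 := fin_key φ S hS n d f Y ?_
    · change 0 ≤ LL G0 Z
      rw [hb G0 hG0]
      simp only [G0, if_true, Complex.ofReal_re, ← Finset.sum_mul]
      linarith
    · intro x y
      have h2 := (mem_coneE Z).1 hc (Sum.elim x y)
      rw [hb _ (by intro a b; simp [mul_comm])] at h2
      have h3 : ∀ z : ℂ, (conj z * z).re = ‖z‖ ^ 2 := by
        intro z
        rw [← Complex.normSq_eq_conj_mul_self, Complex.normSq_eq_norm_sq, Complex.ofReal_re]
      simpa only [Sum.elim_inl, Sum.elim_inr, h3] using h2
  obtain ⟨g, hg1, hg2⟩ := riesz_extension coneE ⟨WW, (LL G0).comp WW.subtype⟩ nonneg dense_WW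
  replace hg1 : ∀ Z ∈ WW, g Z = LL G0 Z := fun Z hZ => hg1 ⟨Z, hZ⟩
  let G : II → II → ℂ := fun a b =>
    ⟨g (Finsupp.single (a, b) 1), - g (Finsupp.single (a, b) Complex.I)⟩
  have hGs : ∀ a b z, g (Finsupp.single (a, b) z) = (z * G a b).re := by
    intro a b z
    have : (Finsupp.single (a, b) z : EE) =
        z.re • Finsupp.single (a, b) 1 + z.im • Finsupp.single (a, b) Complex.I := by
      rw [Finsupp.smul_single, Finsupp.smul_single, ← Finsupp.single_add]
      congr 1
      apply Complex.ext <;> simp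
    rw [this, map_add, map_smul, map_smul, Complex.mul_re]
    simp [G]
  have ext : ∀ u v : ℂ, (∀ z : ℂ, (z * u).re = (z * v).re) → u = v := by
    intro u v h
    have h1 := h 1
    have h2 := h Complex.I
    simp at h1 h2
    exact Complex.ext h1 h2
  have hGW : ∀ a b, (∀ z, (Finsupp.single (a, b) z : EE) ∈ WW) → G a b = G0 a b := by
    intro a b h
    refine ext _ _ fun z => ?_
    rw [← hGs, hg1 _ (h z), LL_single]
  refine ⟨G, ?_, ?_, ?_, ?_⟩
  · intro a b
    refine ext _ _ fun z => ?_
    have hs : ∀ z, 0 ≤ g (Finsupp.single (b, a) z - Finsupp.single (a, b) (conj z)) := by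
      intro z
      apply hg2
      rw [mem_coneE]
      intro x
      rw [map_sub, LL_single, LL_single]
      apply le_of_eq
      simp
      ring
    have h1 := hs z
    have h2 := hs (-z)
    rw [map_sub, hGs, hGs] at h1 h2
    have h3 : (z * conj (G a b)).re = (conj z * G a b).re := by simp
    rw [h3]
    simp at h1 h2 ⊢
    linarith
  · intro a
    rw [hGW a a (single_diag_mem a)]
    rcases a with a | a <;> simp [G0]
  · intro i j
    rw [hGW _ _ (single_off_mem i j)]
  · intro w
    have h := hg2 (w.sum fun a z => w.sum fun b z' => Finsupp.single (a, b) (conj z * z')) ?_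
    · simpa only [Finsupp.sum, map_sum, hGs, Complex.re_sum] using h
    · rw [mem_coneE]
      intro x
      simp only [Finsupp.sum, map_sum, LL_single]
      rw [← Finset.sum_congr rfl (fun a _ => Complex.re_sum _ _), ← Complex.re_sum]
      have : ∑ a ∈ w.support, ∑ b ∈ w.support, conj (w a) * w b * (conj (x a) * x b)
        = conj (∑ a ∈ w.support, w a * x a) * (∑ a ∈ w.support, w a * x a) := by
        rw [map_sum, Finset.sum_mul_sum]
        refine Finset.sum_congr rfl fun i _ => Finset.sum_congr rfl fun j _ => ?_
        rw [map_mul]; ring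
      rw [this, ← Complex.normSq_eq_conj_mul_self, Complex.ofReal_re]
      exact Complex.normSq_nonneg _


lemma gram_expand {H : Type*} [NormedAddCommGroup H] [InnerProductSpace ℂ H] (f : ℕ → H) :
    ∃ c : ℕ → ℕ → ℂ, (∀ m k, m < k → c k m = 0) ∧
      ∀ m m', ⟪f m, f m'⟫_ℂ = ∑' k, conj (c k m) * c k m' := by
  let h := InnerProductSpace.gramSchmidtNormed ℂ f
  have hself : ∀ l, ⟪h l, h l⟫_ℂ • h l = h l := by
    intro l
    by_cases h0 : h l = 0
    · simp [h0]
    · rw [inner_self_eq_norm_sq_to_K, InnerProductSpace.gramSchmidtNormed_unit_length' h0]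
      simp
  have hort : ∀ k l, k ≠ l → ⟪h k, h l⟫_ℂ = 0 := by
    intro k l hkl
    simp [h, InnerProductSpace.gramSchmidtNormed, inner_smul_left, inner_smul_right,
      InnerProductSpace.gramSchmidt_orthogonal ℂ f hkl]
  have hz : ∀ m k, m < k → ⟪h k, f m⟫_ℂ = 0 := by
    intro m k hk
    simp [h, InnerProductSpace.gramSchmidtNormed, inner_smul_left,
      InnerProductSpace.gramSchmidt_inv_triangular ℂ f hk]
  have hexp : ∀ m, f m = ∑ k ∈ Finset.range (m + 1), ⟪h k, f m⟫_ℂ • h k := by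
    intro m
    have hm : f m ∈ Submodule.span ℂ (h '' Set.Iic m) := by
      rw [InnerProductSpace.span_gramSchmidtNormed]
      exact InnerProductSpace.mem_span_gramSchmidt ℂ f le_rfl
    have key : ∀ x ∈ Submodule.span ℂ (h '' Set.Iic m),
        x = ∑ k ∈ Finset.range (m + 1), ⟪h k, x⟫_ℂ • h k := by
      intro x hx
      induction hx using Submodule.span_induction with
      | mem x hx =>
        obtain ⟨l, hl, rfl⟩ := hx
        rw [Finset.sum_eq_single l, hself]
        · intro k _ hk
          rw [hort k l hk, zero_smul]
        · intro hl'
          exact absurd (Finset.mem_range.2 (Nat.lt_succ_of_le hl)) hl'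
      | zero => simp
      | add x y _ _ hx hy =>
        simp only [inner_add_right, add_smul, Finset.sum_add_distrib]
        rw [← hx, ← hy]
      | smul a x _ hx =>
        simp only [inner_smul_right, mul_smul, ← Finset.smul_sum]
        rw [← hx]
    exact key _ hm
  refine ⟨fun k m => ⟪h k, f m⟫_ℂ, hz, fun m m' => ?_⟩
  rw [tsum_eq_sum (s := Finset.range (m' + 1))]
  · conv_lhs => rw [hexp m', inner_sum]
    refine Finset.sum_congr rfl fun k _ => ?_
    rw [inner_smul_right, inner_conj_symm, mul_comm]
  · intro k hk
    have h0 : ⟪h k, f m'⟫_ℂ = 0 := hz m' k (by simpa using hk)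
    simp [h0]

lemma kernel_vectors (G : II → II → ℂ) (hG : ∀ a b, G b a = conj (G a b))
    (hp : ∀ w : II →₀ ℂ, 0 ≤ (w.sum fun a z => w.sum fun b z' => conj z * z' * G a b).re) :
    ∃ c : ℕ → II → ℂ, (∀ a, ∃ n, ∀ k, n ≤ k → c k a = 0) ∧
      ∀ a b, G a b = ∑' k, conj (c k a) * c k b := by
  let K : Matrix II II (ℂ →L[ℂ] ℂ) := fun a b => G a b • ContinuousLinearMap.id ℂ ℂ
  have hK : K.PosSemidef := by
    have tf := (RKHS.posSemidef_tfae (K := K)).out 0 2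
    refine tf.2 ⟨?_, ?_⟩
    · ext a b
      rw [Matrix.conjTranspose_apply]
      simp only [K]
      rw [hG a b]
      have h1 : star (ContinuousLinearMap.id ℂ ℂ) = ContinuousLinearMap.id ℂ ℂ :=
        star_one (ℂ →L[ℂ] ℂ)
      simp [h1]
    · intro w
      have := hp w
      have h2 : ∀ x x' (z z' : ℂ), ⟪(K x' x) z, z'⟫_ℂ = conj z * z' * G x x' := by
        intro x x' z z'
        rw [hG x' x]
        simp [K]
        ring
      simp only [h2]
      exact this
  have : Fact K.PosSemidef := ⟨hK⟩
  let v : II → RKHS.OfKernel K := fun a => RKHS.kerFun (RKHS.OfKernel K) a 1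
  have hv : ∀ a b, ⟪v a, v b⟫_ℂ = G a b := by
    intro a b
    rw [← RKHS.kernel_inner, RKHS.OfKernel.kernel_ofKernel]
    simp [K, ← hG]
  let eq : ℕ ≃ II := (Denumerable.eqv II).symm
  obtain ⟨c, hc1, hc2⟩ := gram_expand (fun n => v (eq n))
  refine ⟨fun k a => c k (eq.symm a), fun a => ⟨eq.symm a + 1, fun k hk => hc1 _ _ hk⟩, fun a b => ?_⟩
  rw [← hc2, Equiv.apply_symm_apply, Equiv.apply_symm_apply, hv]

theorem dir1 (φ : ℕ × ℕ → ℂ) (C : ℝ) (S : (l2 →L[ℂ] l2) →L[ℂ] (l2 →L[ℂ] l2))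
    (hS : ∀ A : l2 →L[ℂ] l2, ∀ i j, ent (S A) i j = φ (i, j) * ent A i j) (hSC : ‖S‖ < C) :
    ∃ a b : ℕ → ℕ → ℂ,
        (∀ k, ∃ c, ∀ i, ‖a k i‖ ≤ c) ∧ (∀ k, ∃ c, ∀ j, ‖b k j‖ ≤ c) ∧
        (∀ i, Summable fun k => ‖a k i‖ ^ 2) ∧ (∀ j, Summable fun k => ‖b k j‖ ^ 2) ∧
        BddAbove (Set.range fun i => ∑' k, ‖a k i‖ ^ 2) ∧
        BddAbove (Set.range fun j => ∑' k, ‖b k j‖ ^ 2) ∧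
        (⨆ i, ∑' k, ‖a k i‖ ^ 2) < C ∧ (⨆ j, ∑' k, ‖b k j‖ ^ 2) < C ∧
        ∀ i j, φ (i, j) = ∑' k, a k i * b k j := by
  obtain ⟨G, h1, h2, h3, h4⟩ := exists_kernel φ S hS
  obtain ⟨c, hc1, hc2⟩ := kernel_vectors G h1 h4
  have hsum : ∀ a, Summable fun k => ‖c k a‖ ^ 2 := by
    intro a
    obtain ⟨n, hn⟩ := hc1 a
    refine summable_of_ne_finset_zero (s := Finset.range n) fun k hk => ?_
    rw [hn k (by simpa using hk)]; simp
  have hts : ∀ a, ∑' k, ‖c k a‖ ^ 2 = ‖S‖ := by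
    intro a
    have := hc2 a a
    simp only [h2, ← Complex.normSq_eq_conj_mul_self, Complex.normSq_eq_norm_sq,
      ← Complex.ofReal_tsum] at this
    exact (Complex.ofReal_injective this).symm
  have hbd : ∀ k a, ‖c k a‖ ≤ √‖S‖ := by
    intro k a
    apply Real.le_sqrt_of_sq_le
    rw [← hts a]
    exact (hsum a).le_tsum k (fun _ _ => by positivity)
  refine ⟨fun k i => conj (c k (Sum.inl i)), fun k j => c k (Sum.inr j), ?_⟩
  simp only [RCLike.norm_conj, hts]
  refine ⟨fun k => ⟨_, fun i => hbd _ _⟩, fun k => ⟨_, fun i => hbd _ _⟩, fun i => hsum _,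
    fun i => hsum _, ?_, ?_, ?_, ?_, fun i j => ?_⟩
  · simp
  · simp
  · simpa using hSC
  · simpa using hSC
  · rw [← h3, hc2]


lemma memlp_mul (c : ℕ → ℂ) (h : ∃ r, ∀ i, ‖c i‖ ≤ r) (x : l2) :
    Memℓp (fun i => c i * x i) 2 := by
  obtain ⟨r, hr⟩ := h
  have hx := (lp.memℓp x).summable (by norm_num)
  refine memℓp_gen ?_
  refine Summable.of_nonneg_of_le (fun i => by positivity) (fun i => ?_) (hx.mul_left (r ^ 2))
  have h1 : (0 : ℝ) ≤ ‖c i‖ := norm_nonneg _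
  have h2 : ‖c i‖ ^ 2 ≤ r ^ 2 := by gcongr; exact hr i
  simp only [norm_mul, ENNReal.toReal_ofNat, Real.rpow_ofNat, mul_pow]
  gcongr

def dg (c : ℕ → ℂ) (h : ∃ r, ∀ i, ‖c i‖ ≤ r) : l2 →ₗ[ℂ] l2 where
  toFun x := ⟨fun i => c i * x i, memlp_mul c h x⟩
  map_add' x y := by
    ext i
    exact mul_add _ _ _
  map_smul' a x := by
    ext i
    simp [mul_left_comm]

lemma dg_apply (c : ℕ → ℂ) (h : ∃ r, ∀ i, ‖c i‖ ≤ r) (x : l2) (i : ℕ) :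
    dg c h x i = c i * x i := rfl

lemma dg_e (c : ℕ → ℂ) (h : ∃ r, ∀ i, ‖c i‖ ≤ r) (i : ℕ) : dg c h (e i) = c i • e i := by
  ext j
  rw [dg_apply, lp.coeFn_smul, Pi.smul_apply, e_apply, smul_eq_mul]
  by_cases hj : j = i <;> simp [hj]

lemma hasSum_sq (x : l2) : HasSum (fun i => ‖x i‖ ^ 2) (‖x‖ ^ 2) := by
  have := lp.hasSum_norm (p := 2) (by norm_num) x
  simpa using this

lemma dg_sum (c : ℕ → ℕ → ℂ) (h : ∀ k, ∃ r, ∀ i, ‖c k i‖ ≤ r) (M : ℝ)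
    (hs : ∀ i, Summable fun k => ‖c k i‖ ^ 2) (hM : ∀ i, ∑' k, ‖c k i‖ ^ 2 ≤ M) (x : l2)
    (s : Finset ℕ) : ∑ k ∈ s, ‖dg (c k) (h k) x‖ ^ 2 ≤ M * ‖x‖ ^ 2 := by
  refine hasSum_le (fun j => ?_) (hasSum_sum fun k _ => hasSum_sq (dg (c k) (h k) x))
    ((hasSum_sq x).mul_left M)
  simp only [dg_apply, norm_mul, mul_pow, ← Finset.sum_mul]
  gcongr
  exact ((hs j).sum_le_tsum s (fun _ _ => by positivity)).trans (hM j)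

theorem dir2 (φ : ℕ × ℕ → ℂ) (a b : ℕ → ℕ → ℂ) (M : ℝ) (hM : 0 ≤ M)
    (ha : ∀ k, ∃ c, ∀ i, ‖a k i‖ ≤ c) (hb : ∀ k, ∃ c, ∀ j, ‖b k j‖ ≤ c)
    (has : ∀ i, Summable fun k => ‖a k i‖ ^ 2) (hbs : ∀ j, Summable fun k => ‖b k j‖ ^ 2)
    (haM : ∀ i, ∑' k, ‖a k i‖ ^ 2 ≤ M) (hbM : ∀ i, ∑' k, ‖b k i‖ ^ 2 ≤ M)
    (hφ : ∀ i j, φ (i, j) = ∑' k, a k i * b k j) (A : l2 →L[ℂ] l2) :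
    ∃ B : l2 →L[ℂ] l2, (∀ i j, ent B i j = φ (i, j) * ent A i j) ∧ ‖B‖ ≤ M * ‖A‖ := by
  have hb' : ∀ k, ∃ c, ∀ j, ‖conj (b k j)‖ ≤ c := by simpa only [RCLike.norm_conj] using hb
  let P : ℕ → l2 →ₗ[ℂ] l2 := fun k => dg (fun j => conj (b k j)) (hb' k)
  let Q : ℕ → l2 →ₗ[ℂ] l2 := fun k => dg (a k) (ha k)
  have hP : ∀ x s, ∑ k ∈ s, ‖P k x‖ ^ 2 ≤ M * ‖x‖ ^ 2 :=
    dg_sum (fun k j => conj (b k j)) hb' M (by simpa only [RCLike.norm_conj] using hbs)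
      (by simpa only [RCLike.norm_conj] using hbM)
  have hQ : ∀ x s, ∑ k ∈ s, ‖Q k x‖ ^ 2 ≤ M * ‖x‖ ^ 2 := dg_sum a ha M has haM
  have bound : ∀ x y (s : Finset ℕ), ∑ k ∈ s, ‖⟪A (P k x), Q k y⟫_ℂ‖ ≤ M * ‖A‖ * ‖x‖ * ‖y‖ := by
    intro x y s
    calc ∑ k ∈ s, ‖⟪A (P k x), Q k y⟫_ℂ‖ ≤ ∑ k ∈ s, ‖A‖ * (‖P k x‖ * ‖Q k y‖) := by
          refine Finset.sum_le_sum fun k _ => (norm_inner_le_norm _ _).trans ?_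
          rw [← mul_assoc]
          gcongr
          exact A.le_opNorm _
      _ = ‖A‖ * ∑ k ∈ s, ‖P k x‖ * ‖Q k y‖ := by rw [Finset.mul_sum]
      _ ≤ ‖A‖ * (√(∑ k ∈ s, ‖P k x‖ ^ 2) * √(∑ k ∈ s, ‖Q k y‖ ^ 2)) := by
          gcongr
          exact Real.sum_mul_le_sqrt_mul_sqrt _ _ _
      _ ≤ ‖A‖ * (√(M * ‖x‖ ^ 2) * √(M * ‖y‖ ^ 2)) := by
          gcongr
          · exact hP x s
          · exact hQ y s
      _ = M * ‖A‖ * ‖x‖ * ‖y‖ := by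
          rw [Real.sqrt_mul hM, Real.sqrt_mul hM, Real.sqrt_sq (norm_nonneg _),
            Real.sqrt_sq (norm_nonneg _)]
          have := Real.mul_self_sqrt hM
          linear_combination (‖A‖ * ‖x‖ * ‖y‖) * this
  have hsn : ∀ x y, Summable fun k => ‖⟪A (P k x), Q k y⟫_ℂ‖ := fun x y =>
    summable_of_sum_le (fun _ => norm_nonneg _) (bound x y)
  have hsum : ∀ x y, Summable fun k => ⟪A (P k x), Q k y⟫_ℂ := fun x y => (hsn x y).of_norm
  let F : l2 →ₗ⋆[ℂ] l2 →ₗ[ℂ] ℂ := LinearMap.mk₂'ₛₗ (starRingEnd ℂ) (RingHom.id ℂ)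
    (fun x y => ∑' k, ⟪A (P k x), Q k y⟫_ℂ)
    (by
      intro x x' y
      rw [← (hsum x y).tsum_add (hsum x' y)]
      simp only [map_add, inner_add_left])
    (by
      intro c x y
      simp only [map_smul, inner_smul_left, smul_eq_mul, tsum_mul_left])
    (by
      intro x y y'
      rw [← (hsum x y).tsum_add (hsum x y')]
      simp only [map_add, inner_add_right])
    (by
      intro c x y
      simp only [map_smul, inner_smul_right, smul_eq_mul, tsum_mul_left, RingHom.id_apply])
  have hF : ∀ x y, ‖F x y‖ ≤ M * ‖A‖ * ‖x‖ * ‖y‖ := by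
    intro x y
    change ‖∑' k, ⟪A (P k x), Q k y⟫_ℂ‖ ≤ _
    exact (norm_tsum_le_tsum_norm (hsn x y)).trans
      ((hsn x y).tsum_le_of_sum_le (bound x y))
  let Fc := F.mkContinuous₂ (M * ‖A‖) hF
  let B := InnerProductSpace.continuousLinearMapOfBilin Fc
  have hB : ∀ x y, ⟪B x, y⟫_ℂ = ∑' k, ⟪A (P k x), Q k y⟫_ℂ := by
    intro x y
    rw [InnerProductSpace.continuousLinearMapOfBilin_apply]
    rfl
  refine ⟨B, fun i j => ?_, ?_⟩
  · rw [ent, hB, hφ, ← tsum_mul_right]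
    refine tsum_congr fun k => ?_
    simp only [P, Q, dg_e, map_smul, inner_smul_left, inner_smul_right, Complex.conj_conj, ent]
    ring
  · refine ContinuousLinearMap.opNorm_le_of_re_inner_le (by positivity) fun x y hx hy => ?_
    refine (RCLike.re_le_norm _).trans ?_
    rw [hB]
    refine (hF x y).trans ?_
    rw [hx, hy, mul_one, mul_one]

lemma ent_ext {A B : l2 →L[ℂ] l2} (h : ∀ i j, ent A i j = ent B i j) : A = B := by
  refine lp.ext_continuousLinearMap (by norm_num) fun j => ?_
  apply ContinuousLinearMap.ext_ring
  ext i
  have := h i j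
  rw [ent, ent, inner_e_right, inner_e_right] at this
  exact (starRingEnd ℂ).injective this

lemma ent_add (A B : l2 →L[ℂ] l2) (i j : ℕ) : ent (A + B) i j = ent A i j + ent B i j := by
  simp [ent, inner_add_left]

lemma ent_smul (c : ℂ) (A : l2 →L[ℂ] l2) (i j : ℕ) : ent (c • A) i j = conj c * ent A i j := by
  simp only [ent, ContinuousLinearMap.smul_apply, inner_smul_left]

/-- Grothendieck: For a bounded `φ : ℕ × ℕ → ℂ` and `C > 0`, the following
are equivalent: (i) `φ` is a Schur multiplier with `‖φ‖_m < C` (i.e. there is a bounded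
linear map `S` on `B(ℓ²)` realising the Schur multiplication by `φ` with `‖S‖ < C`);
(ii) there are sequences of bounded functions `a_k, b_k` with
`sup_i Σ_k |a_k(i)|² < C`, `sup_j Σ_k |b_k(j)|² < C` and
`φ(i,j) = Σ_{k=1}^∞ a_k(i) b_k(j)` for all `i, j`. -/
theorem grothendieck_characterisation (φ : ℕ × ℕ → ℂ) (Cb : ℝ)
    (hφb : ∀ p : ℕ × ℕ, ‖φ p‖ ≤ Cb) (C : ℝ) (hC : 0 < C) :
    (∃ S : (l2 →L[ℂ] l2) →L[ℂ] (l2 →L[ℂ] l2),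
        (∀ A : l2 →L[ℂ] l2, ∀ i j, ent (S A) i j = φ (i, j) * ent A i j) ∧ ‖S‖ < C)
    ↔ (∃ a b : ℕ → ℕ → ℂ,
        (∀ k, ∃ c, ∀ i, ‖a k i‖ ≤ c) ∧ (∀ k, ∃ c, ∀ j, ‖b k j‖ ≤ c) ∧
        (∀ i, Summable fun k => ‖a k i‖ ^ 2) ∧ (∀ j, Summable fun k => ‖b k j‖ ^ 2) ∧
        BddAbove (Set.range fun i => ∑' k, ‖a k i‖ ^ 2) ∧
        BddAbove (Set.range fun j => ∑' k, ‖b k j‖ ^ 2) ∧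
        (⨆ i, ∑' k, ‖a k i‖ ^ 2) < C ∧ (⨆ j, ∑' k, ‖b k j‖ ^ 2) < C ∧
        ∀ i j, φ (i, j) = ∑' k, a k i * b k j) := by
  constructor
  · rintro ⟨S, hS, hSC⟩
    exact dir1 φ C S hS hSC
  · rintro ⟨a, b, ha, hb, has, hbs, hab, hbb, haC, hbC, hφ⟩
    let M : ℝ := max 0 (max (⨆ i, ∑' k, ‖a k i‖ ^ 2) (⨆ j, ∑' k, ‖b k j‖ ^ 2))
    have hM : 0 ≤ M := le_max_left _ _
    have hMC : M < C := max_lt hC (max_lt haC hbC)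
    have haM : ∀ i, ∑' k, ‖a k i‖ ^ 2 ≤ M := fun i =>
      (le_ciSup hab i).trans ((le_max_left _ _).trans (le_max_right _ _))
    have hbM : ∀ i, ∑' k, ‖b k i‖ ^ 2 ≤ M := fun i =>
      (le_ciSup hbb i).trans ((le_max_right _ _).trans (le_max_right _ _))
    choose T hT1 hT2 using dir2 φ a b M hM ha hb has hbs haM hbM hφ
    let S : (l2 →L[ℂ] l2) →ₗ[ℂ] (l2 →L[ℂ] l2) :=
      { toFun := T
        map_add' := fun A B => ent_ext fun i j => by
          simp only [ent_add, hT1, mul_add]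
        map_smul' := fun c A => ent_ext fun i j => by
          simp only [ent_smul, hT1, RingHom.id_apply, mul_left_comm] }
    refine ⟨S.mkContinuous M hT2, hT1, ?_⟩
    exact (S.mkContinuous_norm_le hM hT2).trans_lt hMC

end
end

section
/- (Kissin–Shulman.) Let α ⊆ ℝ be a compact set and let h : α → ℂ be a continuous function. Then h is Operator Lipschitz on α if and only if h is commutator bounded on α, i.e. there exists D > 0 such that for every complex Hilbert space H, every bounded selfadjoint operator A on H with spectrum contained in α, and every bounded operator X on H, one has ‖h(A)X − Xh(A)‖ ≤ D‖AX − XA‖. -/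
noncomputable section

/-- `h(A)`: the continuous functional calculus applied to a bounded selfadjoint operator
`A` on a complex Hilbert space, for a complex-valued function `h` of a real variable
(a selfadjoint operator is normal, and its spectrum lies on the real axis). -/
def cfcReal {H : Type} [NormedAddCommGroup H] [InnerProductSpace ℂ H] [CompleteSpace H]
    (h : ℝ → ℂ) (A : H →L[ℂ] H) : H →L[ℂ] H :=
  cfc (fun z : ℂ => h z.re) A

open NormedSpace in
lemma aux_sa {E : Type} [NormedAddCommGroup E] [InnerProductSpace ℂ E] [CompleteSpace E]
    (A T X : E →L[ℂ] E) (hX : IsSelfAdjoint X) (D : ℝ)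
    (hU : ∀ U : unitary (E →L[ℂ] E),
      ‖T * (U : E →L[ℂ] E) - U * T‖ ≤ D * ‖A * (U : E →L[ℂ] E) - U * A‖) :
    ‖T * X - X * T‖ ≤ D * ‖A * X - X * A‖ := by
  have hd : HasDerivAt (fun t : ℝ => exp (t • (Complex.I • X))) (Complex.I • X) 0 := by
    simpa using hasDerivAt_exp_smul_const (𝕂 := ℝ) (Complex.I • X) (0 : ℝ)
  have key : ∀ S : E →L[ℂ] E, Filter.Tendsto
      (fun t : ℝ => ‖t⁻¹ • (S * exp (t • (Complex.I • X)) - exp (t • (Complex.I • X)) * S)‖)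
      (nhdsWithin 0 {0}ᶜ) (nhds ‖S * X - X * S‖) := by
    intro S
    have h1 := ((hd.const_mul S).sub (hd.mul_const S)).tendsto_slope_zero.norm
    have h2 : ‖S * (Complex.I • X) - (Complex.I • X) * S‖ = ‖S * X - X * S‖ := by
      rw [mul_smul_comm, smul_mul_assoc, ← smul_sub, norm_smul]; simp
    rw [h2] at h1
    simpa using h1
  refine le_of_tendsto_of_tendsto (key T) ((key A).const_mul D) ?_
  refine Filter.Eventually.of_forall fun t => ?_
  have := hU (selfAdjoint.expUnitary (t • ⟨X, hX⟩))
  simp only [selfAdjoint.expUnitary_coe] at this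
  have e : Complex.I • ((t • (⟨X, hX⟩ : selfAdjoint (E →L[ℂ] E)) : selfAdjoint (E →L[ℂ] E)) : E →L[ℂ] E)
      = t • (Complex.I • X) := by
    exact smul_comm _ _ _
  rw [e] at this
  simp only [norm_smul]
  calc _ ≤ ‖t⁻¹‖ * (D * _) := mul_le_mul_of_nonneg_left this (norm_nonneg _)
    _ = _ := by ring

lemma aux_cont (α : Set ℝ) (h : ℝ → ℂ) (hc : ContinuousOn h α) :
    ContinuousOn (fun z : ℂ => h z.re) (Complex.ofReal '' α) := by
  refine hc.comp Complex.continuous_re.continuousOn ?_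
  rintro _ ⟨x, hx, rfl⟩
  simpa using hx

section
variable {E : Type} [NormedAddCommGroup E] [InnerProductSpace ℂ E] [CompleteSpace E]

def inA : E →L[ℂ] WithLp 2 (E × E) :=
  (WithLp.prodContinuousLinearEquiv 2 ℂ E E).symm.toContinuousLinearMap ∘L
    ContinuousLinearMap.inl ℂ E E

def inB : E →L[ℂ] WithLp 2 (E × E) :=
  (WithLp.prodContinuousLinearEquiv 2 ℂ E E).symm.toContinuousLinearMap ∘L
    ContinuousLinearMap.inr ℂ E E

def diagOp (p : (E →L[ℂ] E) × (E →L[ℂ] E)) : WithLp 2 (E × E) →L[ℂ] WithLp 2 (E × E) :=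
  inA ∘L p.1 ∘L WithLp.fstL 2 ℂ E E + inB ∘L p.2 ∘L WithLp.sndL 2 ℂ E E

lemma diagOp_apply (p : (E →L[ℂ] E) × (E →L[ℂ] E)) (x : WithLp 2 (E × E)) :
    diagOp p x = WithLp.toLp 2 (p.1 x.fst, p.2 x.snd) := by
  simp [diagOp, inA, inB, ← WithLp.toLp_add]

def diagHom : ((E →L[ℂ] E) × (E →L[ℂ] E)) →⋆ₐ[ℂ]
    (WithLp 2 (E × E) →L[ℂ] WithLp 2 (E × E)) where
  toFun := diagOp
  map_one' := by ext x : 1; apply WithLp.ofLp_injective 2; ext <;> simp [diagOp_apply]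
  map_mul' p q := by ext x : 1; apply WithLp.ofLp_injective 2; ext <;> simp [diagOp_apply]
  map_zero' := by ext x : 1; apply WithLp.ofLp_injective 2; ext <;> simp [diagOp_apply]
  map_add' p q := by ext x : 1; apply WithLp.ofLp_injective 2; ext <;> simp [diagOp_apply]
  commutes' r := by ext x : 1; apply WithLp.ofLp_injective 2; ext <;> simp [diagOp_apply, Algebra.algebraMap_eq_smul_one]
  map_star' p := by
    rw [ContinuousLinearMap.star_eq_adjoint, ContinuousLinearMap.eq_adjoint_iff]
    intro x y
    simp [diagOp_apply, ContinuousLinearMap.star_eq_adjoint, ContinuousLinearMap.adjoint_inner_left]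

lemma diagHom_apply (p : (E →L[ℂ] E) × (E →L[ℂ] E)) (x : WithLp 2 (E × E)) :
    diagHom p x = WithLp.toLp 2 (p.1 x.fst, p.2 x.snd) := diagOp_apply p x

lemma inA_norm (x : E) : ‖(inA x : WithLp 2 (E × E))‖ = ‖x‖ := by
  simp [inA]

lemma inB_norm (x : E) : ‖(inB x : WithLp 2 (E × E))‖ = ‖x‖ := by
  simp [inB]

def offX : WithLp 2 (E × E) →L[ℂ] WithLp 2 (E × E) := inA ∘L WithLp.sndL 2 ℂ E E

lemma comm_eq (A B : E →L[ℂ] E) :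
    diagHom (A, B) * offX - offX * diagHom (A, B) = inA ∘L (A - B) ∘L WithLp.sndL 2 ℂ E E := by
  ext x; simp [diagHom_apply, offX, inA]

lemma norm_comm (A B : E →L[ℂ] E) :
    ‖diagHom (A, B) * offX - offX * diagHom (A, B)‖ = ‖A - B‖ := by
  rw [comm_eq]
  apply le_antisymm
  · refine ContinuousLinearMap.opNorm_le_bound _ (norm_nonneg _) fun x => ?_
    simp only [ContinuousLinearMap.comp_apply, inA_norm]
    refine (ContinuousLinearMap.le_opNorm _ _).trans ?_
    gcongr
    exact WithLp.norm_snd_le _ x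
  · refine ContinuousLinearMap.opNorm_le_bound _ (norm_nonneg _) fun x => ?_
    have := ContinuousLinearMap.le_opNorm
      (inA ∘L (A - B) ∘L WithLp.sndL 2 ℂ E E) (inB x)
    rw [inB_norm] at this
    simp only [ContinuousLinearMap.comp_apply, inA_norm] at this
    simpa [inB] using this

end

/-- Kissin–Shulman: For a compact set `α ⊆ ℝ` and a continuous function
`h` on `α`, `h` is Operator Lipschitz on `α` if and only if `h` is commutator bounded on
`α`. -/
theorem operatorLipschitz_iff_commutatorBounded (α : Set ℝ) (hα : IsCompact α)
    (h : ℝ → ℂ) (hc : ContinuousOn h α) :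
    (∃ D > (0 : ℝ), ∀ (H : Type) [NormedAddCommGroup H] [InnerProductSpace ℂ H]
        [CompleteSpace H], ∀ A B : H →L[ℂ] H,
        IsSelfAdjoint A → IsSelfAdjoint B →
        spectrum ℂ A ⊆ Complex.ofReal '' α → spectrum ℂ B ⊆ Complex.ofReal '' α →
        ‖cfcReal h A - cfcReal h B‖ ≤ D * ‖A - B‖)
    ↔ (∃ D > (0 : ℝ), ∀ (H : Type) [NormedAddCommGroup H] [InnerProductSpace ℂ H]
        [CompleteSpace H], ∀ A X : H →L[ℂ] H,
        IsSelfAdjoint A → spectrum ℂ A ⊆ Complex.ofReal '' α →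
        ‖cfcReal h A * X - X * cfcReal h A‖ ≤ D * ‖A * X - X * A‖) := by
  constructor
  · rintro ⟨D, hD, hL⟩
    refine ⟨2 * D, by positivity, ?_⟩
    intro H _ _ _ A X hA hsA
    have hcA : ContinuousOn (fun z : ℂ => h z.re) (spectrum ℂ A) := (aux_cont α h hc).mono hsA
    have hAn : IsStarNormal A := hA.isStarNormal
    have hU : ∀ U : unitary (H →L[ℂ] H),
        ‖cfcReal h A * (U : H →L[ℂ] H) - U * cfcReal h A‖
          ≤ D * ‖A * (U : H →L[ℂ] H) - U * A‖ := by
      intro U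
      let φ := Unitary.conjStarAlgAut ℂ (H →L[ℂ] H) U
      have hφc : Continuous φ := by
        change Continuous fun x => (U : H →L[ℂ] H) * x * (star U : H →L[ℂ] H)
        fun_prop
      have hφA : IsSelfAdjoint (φ A) := hA.map φ
      have hsp : spectrum ℂ (φ A) ⊆ Complex.ofReal '' α :=
        (AlgHom.spectrum_apply_subset φ A).trans hsA
      have hmap : φ (cfcReal h A) = cfcReal h (φ A) :=
        StarAlgHomClass.map_cfc (S := ℂ) φ (fun z : ℂ => h z.re) A hcA hφc hAn hφA.isStarNormal
      have h1 := hL H (φ A) A hφA hA hsp hsA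
      rw [← hmap] at h1
      have hn : ∀ S : H →L[ℂ] H, ‖φ S - S‖ = ‖S * (U : H →L[ℂ] H) - U * S‖ := by
        intro S
        have : φ S - S = -((S * (U : H →L[ℂ] H) - U * S) * ((star U : unitary _) : H →L[ℂ] H)) := by
          simp only [φ, Unitary.conjStarAlgAut_apply, sub_mul, mul_assoc, neg_sub]
          simp
        rw [this, norm_neg, CStarRing.norm_mul_coe_unitary]
      rwa [hn, hn] at h1
    have hS : ∀ Y : H →L[ℂ] H, IsSelfAdjoint Y →
        ‖cfcReal h A * Y - Y * cfcReal h A‖ ≤ D * ‖A * Y - Y * A‖ :=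
      fun Y hY => aux_sa A _ Y hY D hU
    set T := cfcReal h A
    have hst : ‖A * star X - star X * A‖ = ‖A * X - X * A‖ := by
      rw [← norm_star (A * X - X * A), ← norm_neg]
      simp [hA.star_eq]
    have e1 := hS (X + star X) (IsSelfAdjoint.add_star_self X)
    have e2 := hS (Complex.I • (X - star X)) (by
      rw [isSelfAdjoint_iff]; simp [← smul_neg])
    have n1 : ‖A * (X + star X) - (X + star X) * A‖ ≤ 2 * ‖A * X - X * A‖ := by
      have : A * (X + star X) - (X + star X) * A
          = (A * X - X * A) + (A * star X - star X * A) := by noncomm_ring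
      rw [this]
      refine (norm_add_le _ _).trans ?_
      rw [hst]; linarith
    have sm : ∀ S Y : H →L[ℂ] H, ‖S * (Complex.I • Y) - (Complex.I • Y) * S‖ = ‖S * Y - Y * S‖ := by
      intro S Y
      rw [mul_smul_comm, smul_mul_assoc, ← smul_sub, norm_smul]; simp
    rw [sm, sm] at e2
    have n2 : ‖A * (X - star X) - (X - star X) * A‖ ≤ 2 * ‖A * X - X * A‖ := by
      have : A * (X - star X) - (X - star X) * A
          = (A * X - X * A) - (A * star X - star X * A) := by noncomm_ring
      rw [this]
      refine (norm_sub_le _ _).trans ?_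
      rw [hst]; linarith
    have e3 : (2 : ℂ) • (T * X - X * T) = (T * (X + star X) - (X + star X) * T)
        + (T * (X - star X) - (X - star X) * T) := by
      rw [two_smul]; noncomm_ring
    have e4 : 2 * ‖T * X - X * T‖ ≤ ‖T * (X + star X) - (X + star X) * T‖
        + ‖T * (X - star X) - (X - star X) * T‖ := by
      have := norm_add_le (T * (X + star X) - (X + star X) * T)
        (T * (X - star X) - (X - star X) * T)
      rw [← e3, norm_smul] at this
      simpa using this
    have m1 := mul_le_mul_of_nonneg_left n1 hD.le
    have m2 := mul_le_mul_of_nonneg_left n2 hD.le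
    linarith
  · rintro ⟨D, hD, hL⟩
    refine ⟨D, hD, ?_⟩
    intro H _ _ _ A B hA hB hsA hsB
    have hAB : IsSelfAdjoint ((A, B) : (H →L[ℂ] H) × (H →L[ℂ] H)) :=
      Prod.ext hA.star_eq hB.star_eq
    have hsAB : spectrum ℂ ((A, B) : (H →L[ℂ] H) × (H →L[ℂ] H)) ⊆ Complex.ofReal '' α := by
      rw [Prod.spectrum_eq]; exact Set.union_subset hsA hsB
    have hcont := aux_cont α h hc
    have hφ : IsSelfAdjoint (diagHom (A, B)) := hAB.map diagHom
    have hcd : Continuous (diagHom (E := H)) := by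
      change Continuous fun p : (H →L[ℂ] H) × (H →L[ℂ] H) => diagOp p
      unfold diagOp
      fun_prop
    have h1 : cfc (fun z : ℂ => h z.re) ((A, B) : (H →L[ℂ] H) × (H →L[ℂ] H))
        = (cfcReal h A, cfcReal h B) :=
      cfc_map_prod (S := ℂ) (fun z : ℂ => h z.re) A B
        (hcont.mono (Set.union_subset hsA hsB)) hAB.isStarNormal hA.isStarNormal hB.isStarNormal
    have h2 : diagHom (cfc (fun z : ℂ => h z.re) ((A, B) : (H →L[ℂ] H) × (H →L[ℂ] H)))
        = cfcReal h (diagHom (A, B)) :=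
      StarAlgHomClass.map_cfc (S := ℂ) diagHom (fun z : ℂ => h z.re) (A, B)
        (hcont.mono hsAB) hcd hAB.isStarNormal hφ.isStarNormal
    have h3 := hL (WithLp 2 (H × H)) (diagHom (A, B)) offX hφ
      ((AlgHom.spectrum_apply_subset diagHom (A, B)).trans hsAB)
    rw [← h2, h1, norm_comm, norm_comm] at h3
    exact h3
end
end
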